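/- Let m ∈ ℕ, let I : (0,∞) → (0,∞) be a left-continuous non-decreasing function such that Φ_I^m(t,s) is essentially decreasing in t, and let f be a non-negative measurable function on (0,∞) whose support S_f = {t : f(t) > 0} has finite Lebesgue measure s_f. Then there exists t₀ ≥ s_f such that for every t ≥ t₀ there exists r_t ∈ (0,∞) with the property that R_I^m f*(t) ≥ R_I^m f*(r) for all r ≥ r_t. -/

import Mathlib

open MeasureTheory Set Filter
open scoped ENNReal NNReal Topology

noncomputable section

/-- The distribution function of `f`, viewed as a function on `(0,∞)` with Lebesgue measure:
`μ_f(s) = λ({t ∈ (0,∞) : f(t) > s})`. -/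
def distrib (f : ℝ → ℝ≥0∞) (s : ℝ≥0∞) : ℝ≥0∞ :=
  volume {t : ℝ | t ∈ Set.Ioi (0 : ℝ) ∧ s < f t}

/-- The non-increasing rearrangement `f*(t) = inf { s ≥ 0 : μ_f(s) ≤ t }`. -/
def rearr (f : ℝ → ℝ≥0∞) (t : ℝ) : ℝ≥0∞ :=
  sInf {s : ℝ≥0∞ | distrib f s ≤ ENNReal.ofReal t}

/-- The operator `R_I f(t) = (1/I(t)) ∫_0^t f(s) ds`. -/
def RI (I : ℝ → ℝ) (f : ℝ → ℝ≥0∞) : ℝ → ℝ≥0∞ :=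
  fun t => (∫⁻ s in Set.Ioc (0 : ℝ) t, f s) / ENNReal.ofReal (I t)

/-- The operator `H_I f(t) = ∫_t^∞ f(s)/I(s) ds`. -/
def HI (I : ℝ → ℝ) (f : ℝ → ℝ≥0∞) : ℝ → ℝ≥0∞ :=
  fun t => ∫⁻ s in Set.Ioi t, f s / ENNReal.ofReal (I s)

/-- `G_I^m f(t) = sup_{s ≥ t} R_I^m f*(s)`. -/
def GI (I : ℝ → ℝ) (m : ℕ) (f : ℝ → ℝ≥0∞) : ℝ → ℝ≥0∞ :=
  fun t => ⨆ s ∈ Set.Ici t, (RI I)^[m] (rearr f) s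

/-- `Φ_I^m(t,s) = (∫_s^t 1/I(τ) dτ)^(m-1) / I(t)`. -/
def Phi (I : ℝ → ℝ) (m : ℕ) (t s : ℝ) : ℝ :=
  (∫ τ in s..t, 1 / I τ) ^ (m - 1) / I t

/-- `Φ_I^m(t,s)` is essentially decreasing in `t`. -/
def EssentiallyDecreasingIn (I : ℝ → ℝ) (m : ℕ) : Prop :=
  ∀ s₀ ∈ Set.Ioi (0 : ℝ), ∃ t₀ ∈ Set.Ioi (0 : ℝ), ∀ t ∈ Set.Ioi t₀,
    ∃ rt ∈ Set.Ioi (0 : ℝ), ∀ r ∈ Set.Ioi rt, ∀ s ∈ Set.Ioo (0 : ℝ) s₀,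
      Phi I m r s ≤ Phi I m t s

/-- The kernel operator `f ↦ (t ↦ ∫_t^∞ (f(s)/I(s)) (∫_t^s 1/I(r) dr)^(m-1) ds)`. -/
def kernelOp (I : ℝ → ℝ) (m : ℕ) (f : ℝ → ℝ≥0∞) : ℝ → ℝ≥0∞ :=
  fun t => ∫⁻ s in Set.Ioi t,
    (f s / ENNReal.ofReal (I s)) * (ENNReal.ofReal (∫ r in t..s, 1 / I r)) ^ (m - 1)

/-- A Banach function norm on (non-negative) measurable functions on `(0,∞)`
(with Lebesgue measure). -/
structure BanachFunctionNorm where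
  /-- The norm functional. -/
  N : (ℝ → ℝ≥0∞) → ℝ≥0∞
  /-- Positive homogeneity. -/
  smul : ∀ (c : ℝ≥0) (f : ℝ → ℝ≥0∞), Measurable f →
    N (fun t => (c : ℝ≥0∞) * f t) = (c : ℝ≥0∞) * N f
  /-- The norm vanishes exactly on a.e.-zero functions. -/
  eq_zero_iff : ∀ f : ℝ → ℝ≥0∞, Measurable f →
    (N f = 0 ↔ ∀ᵐ t ∂(volume.restrict (Set.Ioi (0 : ℝ))), f t = 0)
  /-- Subadditivity. -/
  add_le : ∀ f g : ℝ → ℝ≥0∞, Measurable f → Measurable g →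
    N (fun t => f t + g t) ≤ N f + N g
  /-- The lattice property. -/
  mono : ∀ f g : ℝ → ℝ≥0∞, Measurable f → Measurable g →
    (∀ᵐ t ∂(volume.restrict (Set.Ioi (0 : ℝ))), f t ≤ g t) → N f ≤ N g
  /-- The Fatou property: `f_n ↑ f` a.e. implies `‖f_n‖ ↑ ‖f‖`. -/
  fatou : ∀ (f : ℕ → ℝ → ℝ≥0∞) (g : ℝ → ℝ≥0∞), (∀ n, Measurable (f n)) →
    Measurable g →
    (∀ᵐ t ∂(volume.restrict (Set.Ioi (0 : ℝ))), Monotone fun n => f n t) →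
    (∀ᵐ t ∂(volume.restrict (Set.Ioi (0 : ℝ))), g t = ⨆ n, f n t) →
    N g = ⨆ n, N (f n)
  /-- Characteristic functions of sets of finite measure have finite norm. -/
  indicator_lt_top : ∀ E : Set ℝ, MeasurableSet E → E ⊆ Set.Ioi (0 : ℝ) →
    volume E < ∞ → N (E.indicator 1) < ∞
  /-- Local embedding into `L¹`. -/
  exists_integral_le : ∀ E : Set ℝ, MeasurableSet E → E ⊆ Set.Ioi (0 : ℝ) →
    volume E < ∞ → ∃ C : ℝ≥0∞, C ≠ ∞ ∧
      ∀ f : ℝ → ℝ≥0∞, Measurable f → ∫⁻ t in E, f t ≤ C * N f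

/-- A rearrangement-invariant Banach function norm: equimeasurable functions have
equal norms. -/
structure RIBanachFunctionNorm extends BanachFunctionNorm where
  /-- Rearrangement invariance. -/
  ri : ∀ f g : ℝ → ℝ≥0∞, Measurable f → Measurable g →
    (∀ s, distrib f s = distrib g s) → N f = N g

/-- The associate norm `‖f‖_{X'} = sup { ∫_0^∞ |f g| : ‖g‖_X ≤ 1 }`. -/
def assocNorm (X : RIBanachFunctionNorm) (f : ℝ → ℝ≥0∞) : ℝ≥0∞ :=
  ⨆ (g : ℝ → ℝ≥0∞) (_ : Measurable g) (_ : X.N g ≤ 1),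
    ∫⁻ t in Set.Ioi (0 : ℝ), f t * g t

/-- The down-associate norm `‖f‖_{X'_d} = sup { ∫_0^∞ |f| g* : ‖g‖_X ≤ 1 }`. -/
def downAssocNorm (X : RIBanachFunctionNorm) (f : ℝ → ℝ≥0∞) : ℝ≥0∞ :=
  ⨆ (g : ℝ → ℝ≥0∞) (_ : Measurable g) (_ : X.N g ≤ 1),
    ∫⁻ t in Set.Ioi (0 : ℝ), f t * rearr g t

section Primitive

variable {k : ℝ → ℝ}

lemma AntitoneOn.intervalIntegrable_of_pos (hk : AntitoneOn k (Ioi 0)) {a b : ℝ}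
    (ha : 0 < a) (hb : 0 < b) : IntervalIntegrable k volume a b :=
  (hk.mono fun _ hx => (lt_min ha hb).trans_le hx.1).intervalIntegrable

lemma AntitoneOn.hasDerivAt_integral_of_pos (hk : AntitoneOn k (Ioi 0)) {a x : ℝ}
    (ha : 0 < a) (hx : 0 < x) (hc : ContinuousWithinAt k (Ioi 0) x) :
    HasDerivAt (fun r => ∫ τ in a..r, k τ) (k x) x := by
  refine intervalIntegral.integral_hasDerivAt_right (hk.intervalIntegrable_of_pos ha hx)
    ⟨Ioi 0, Ioi_mem_nhds hx, ?_⟩ (hc.continuousAt (Ioi_mem_nhds hx))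
  exact (aemeasurable_restrict_of_antitoneOn measurableSet_Ioi hk).aestronglyMeasurable

lemma AntitoneOn.continuousOn_integral_of_pos (hk : AntitoneOn k (Ioi 0)) {a : ℝ}
    (ha : 0 < a) : ContinuousOn (fun r => ∫ τ in a..r, k τ) (Ioi 0) := by
  intro x (hx : 0 < x)
  have hl : 0 < min a (x / 2) := lt_min ha (by linarith)
  have hu : x < max a (x + 1) := lt_max_of_lt_right (by linarith)
  have hlx : min a (x / 2) < x := min_lt_of_right_lt (by linarith)
  have h := intervalIntegral.continuousOn_primitive_interval'
    (hk.intervalIntegrable_of_pos hl (hx.trans hu))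
    (mem_uIcc_of_le (min_le_left a (x / 2)) (le_max_left a (x + 1)))
  exact (h.continuousAt (by
    rw [uIcc_of_le (hlx.trans hu).le]
    exact Icc_mem_nhds hlx hu)).continuousWithinAt

lemma AntitoneOn.integral_primitive_pow_mul (hk : AntitoneOn k (Ioi 0)) (n : ℕ) {s t : ℝ}
    (hs : 0 < s) (hst : s ≤ t) :
    IntervalIntegrable (fun r => (∫ τ in s..r, k τ) ^ n * k r) volume s t ∧
    ∫ r in s..t, (∫ τ in s..r, k τ) ^ n * k r = (∫ τ in s..t, k τ) ^ (n + 1) / (n + 1) := by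
  have hcont : ContinuousOn (fun r => ∫ τ in s..r, k τ) (Icc s t) :=
    (hk.continuousOn_integral_of_pos hs).mono fun x hx => hs.trans_le hx.1
  have hint : IntervalIntegrable (fun r => (∫ τ in s..r, k τ) ^ n * k r) volume s t :=
    (hk.intervalIntegrable_of_pos hs (hs.trans_le hst)).continuousOn_mul
      (by rw [uIcc_of_le hst]; exact hcont.pow n)
  refine ⟨hint, ?_⟩
  have h := integral_eq_of_hasDerivAt_off_countable_of_le
    (fun r => (∫ τ in s..r, k τ) ^ (n + 1) / (n + 1))
    (fun r => (∫ τ in s..r, k τ) ^ n * k r) hst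
    hk.countable_not_continuousWithinAt ((hcont.pow (n + 1)).div_const _) (fun x hx => ?_) hint
  · simpa using h
  · have hx0 : 0 < x := hs.trans hx.1.1
    have hc : ContinuousWithinAt k (Ioi 0) x := by
      by_contra hc
      exact hx.2 ⟨hx0, hc⟩
    have hd := ((hk.hasDerivAt_integral_of_pos hs hx0 hc).pow (n + 1)).div_const ((n : ℝ) + 1)
    refine hd.congr_deriv ?_
    have : (n : ℝ) + 1 ≠ 0 := by positivity
    push_cast
    rw [mul_assoc, mul_div_cancel_left₀ _ this]

lemma AntitoneOn.lintegral_primitive_pow_mul (hk : AntitoneOn k (Ioi 0))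
    (hk0 : ∀ x ∈ Ioi (0 : ℝ), 0 ≤ k x) (n : ℕ) {s t : ℝ} (hs : 0 < s) (hst : s ≤ t) :
    ∫⁻ r in Ioc s t, ENNReal.ofReal ((∫ τ in s..r, k τ) ^ n * k r) =
      ENNReal.ofReal ((∫ τ in s..t, k τ) ^ (n + 1) / (n + 1)) := by
  obtain ⟨hint, heq⟩ := hk.integral_primitive_pow_mul n hs hst
  rw [← heq, intervalIntegral.integral_of_le hst]
  refine (ofReal_integral_eq_lintegral_ofReal ?_ ?_).symm
  · exact (intervalIntegrable_iff_integrableOn_Ioc_of_le hst).1 hint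
  · refine (ae_restrict_iff' measurableSet_Ioc).2 (.of_forall fun r hr => ?_)
    refine mul_nonneg (pow_nonneg (intervalIntegral.integral_nonneg hr.1.le fun u hu => ?_) n)
      (hk0 r (hs.trans hr.1))
    exact hk0 u (hs.trans_le hu.1)

lemma AntitoneOn.aemeasurable_primitive_pow_mul (hk : AntitoneOn k (Ioi 0)) (n : ℕ) (t : ℝ) :
    AEMeasurable (fun p : ℝ × ℝ => (∫ τ in p.2..p.1, k τ) ^ n * k p.1)
      ((volume.restrict (Ioc 0 t)).prod (volume.restrict (Ioc 0 t))) := by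
  have hkm : AEMeasurable k (volume.restrict (Ioc 0 t)) :=
    aemeasurable_restrict_of_antitoneOn measurableSet_Ioc (hk.mono fun _ hx => hx.1)
  have hG : AEMeasurable (fun r => ∫ τ in (1 : ℝ)..r, k τ) (volume.restrict (Ioc 0 t)) :=
    ((hk.continuousOn_integral_of_pos one_pos).mono fun _ hx => hx.1).aemeasurable
      measurableSet_Ioc
  refine (((hG.comp_fst.sub hG.comp_snd).pow_const n).mul hkm.comp_fst).congr ?_
  rw [Measure.prod_restrict]
  refine (ae_restrict_iff' (measurableSet_Ioc.prod measurableSet_Ioc)).2 (.of_forall ?_)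
  rintro ⟨r, s⟩ ⟨hr, hs⟩
  have := intervalIntegral.integral_interval_sub_left
    (hk.intervalIntegrable_of_pos one_pos hr.1) (hk.intervalIntegrable_of_pos one_pos hs.1)
  simp [this]

end Primitive

lemma lintegral_triangle_swap {F : ℝ → ℝ → ℝ≥0∞} {t : ℝ}
    (hF : AEMeasurable (Function.uncurry F)
      ((volume.restrict (Ioc 0 t)).prod (volume.restrict (Ioc 0 t)))) :
    ∫⁻ r in Ioc 0 t, ∫⁻ s in Ioc 0 r, F r s = ∫⁻ s in Ioc 0 t, ∫⁻ r in Ioc s t, F r s := by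
  have hT : MeasurableSet {p : ℝ × ℝ | p.2 ≤ p.1} := measurableSet_le measurable_snd measurable_fst
  have hswap := lintegral_lintegral_swap
    (f := fun r s => {p : ℝ × ℝ | p.2 ≤ p.1}.indicator (Function.uncurry F) (r, s))
    (hF.indicator hT)
  have hl : ∀ r ∈ Ioc 0 t, ∫⁻ s in Ioc 0 r, F r s =
      ∫⁻ s in Ioc 0 t, {p : ℝ × ℝ | p.2 ≤ p.1}.indicator (Function.uncurry F) (r, s) := by
    intro r hr
    have : Ioc 0 r = Iic r ∩ Ioc 0 t := by
      ext x; simp only [mem_Ioc, mem_inter_iff, mem_Iic]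
      exact ⟨fun h => ⟨h.2, h.1, h.2.trans hr.2⟩, fun h => ⟨h.2.1, h.1⟩⟩
    rw [this, ← setLIntegral_indicator measurableSet_Iic]
    rfl
  have hr : ∀ s ∈ Ioc 0 t, ∫⁻ r in Ioc s t, F r s =
      ∫⁻ r in Ioc 0 t, {p : ℝ × ℝ | p.2 ≤ p.1}.indicator (Function.uncurry F) (r, s) := by
    intro s hs
    have : Icc s t = Ici s ∩ Ioc 0 t := by
      ext x; simp only [mem_Ioc, mem_inter_iff, mem_Ici, mem_Icc]
      exact ⟨fun h => ⟨h.1, hs.1.trans_le h.1, h.2⟩, fun h => ⟨h.1, h.2.2⟩⟩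
    rw [setLIntegral_congr Ioc_ae_eq_Icc, this, ← setLIntegral_indicator measurableSet_Ici]
    rfl
  rw [setLIntegral_congr_fun measurableSet_Ioc hl, setLIntegral_congr_fun measurableSet_Ioc hr]
  exact hswap

lemma antitone_rearr (f : ℝ → ℝ≥0∞) : Antitone (rearr f) := fun _ _ h =>
  sInf_le_sInf fun _ hs => le_trans hs (ENNReal.ofReal_le_ofReal h)

lemma rearr_eq_zero {f : ℝ → ℝ≥0∞}
    (hsupp : volume {t : ℝ | t ∈ Set.Ioi (0 : ℝ) ∧ f t ≠ 0} < ∞) {t : ℝ}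
    (ht : (volume {t : ℝ | t ∈ Set.Ioi (0 : ℝ) ∧ f t ≠ 0}).toReal ≤ t) : rearr f t = 0 := by
  refine le_antisymm (sInf_le ?_) zero_le
  simp only [mem_ofPred_eq, distrib, pos_iff_ne_zero]
  exact (ENNReal.le_ofReal_iff_toReal_le hsupp.ne (ENNReal.toReal_nonneg.trans ht)).2 ht

/-- The iterates of `R_I` are integral operators with kernel `Φ_I^m / (m - 1)!`. -/
lemma iterate_RI_eq_lintegral_Phi {I : ℝ → ℝ} (hI : MonotoneOn I (Ioi 0))
    (hIpos : ∀ t ∈ Ioi (0 : ℝ), 0 < I t) {g : ℝ → ℝ≥0∞} (hg : Measurable g) (n : ℕ) {t : ℝ}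
    (ht : 0 < t) :
    (RI I)^[n + 1] g t =
      (∫⁻ s in Ioc 0 t, g s * ENNReal.ofReal (Phi I (n + 1) t s)) / (n.factorial : ℝ≥0∞) := by
  have hk : AntitoneOn (fun τ => 1 / I τ) (Ioi 0) := fun x hx y hy hxy =>
    one_div_le_one_div_of_le (hIpos x hx) (hI hx hy hxy)
  have hk0 : ∀ x ∈ Ioi (0 : ℝ), 0 ≤ 1 / I x := fun x hx => (one_div_pos.2 (hIpos x hx)).le
  induction n generalizing t with
  | zero =>
    simp only [zero_add, Function.iterate_one, RI, Phi, Nat.sub_self, pow_zero,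
      Nat.factorial_zero, Nat.cast_one, div_one]
    rw [lintegral_mul_const _ hg, one_div, ENNReal.ofReal_inv_of_pos (hIpos t ht), div_eq_mul_inv]
  | succ n ih =>
    have hmeas : AEMeasurable (Function.uncurry fun r s : ℝ =>
        g s * ENNReal.ofReal (Phi I (n + 1) r s))
        ((volume.restrict (Ioc 0 t)).prod (volume.restrict (Ioc 0 t))) := by
      refine (hg.comp measurable_snd).aemeasurable.mul ?_
      refine (hk.aemeasurable_primitive_pow_mul n t).ennreal_ofReal.congr (.of_forall ?_)
      rintro ⟨r, s⟩
      simp [Phi, div_eq_mul_inv]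
    have hinner : ∀ s ∈ Ioc 0 t, ∫⁻ r in Ioc s t, g s * ENNReal.ofReal (Phi I (n + 1) r s) =
        g s * ENNReal.ofReal (Phi I (n + 2) t s) * (ENNReal.ofReal (I t / (n + 1))) := by
      intro s hs
      have hm := (hk.integral_primitive_pow_mul n hs.1 hs.2).1.aestronglyMeasurable
      have hl := hk.lintegral_primitive_pow_mul hk0 n hs.1 hs.2
      simp only [mul_one_div] at hm hl
      simp only [Phi, Nat.add_succ_sub_one, Nat.add_zero]
      rw [lintegral_const_mul'' _ hm.aemeasurable.ennreal_ofReal, mul_assoc,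
        ← ENNReal.ofReal_mul' (div_pos (hIpos t ht) (by positivity)).le]
      refine congrArg (g s * ·) (hl.trans (congrArg ENNReal.ofReal ?_))
      have := (hIpos t ht).ne'
      field_simp
    rw [Function.iterate_succ_apply', RI,
      setLIntegral_congr_fun measurableSet_Ioc fun r hr => ih hr.1]
    simp only [div_eq_mul_inv]
    rw [lintegral_mul_const'  _ _ (by simp [Nat.factorial_ne_zero]),
      lintegral_triangle_swap hmeas, setLIntegral_congr_fun measurableSet_Ioc hinner,
      lintegral_mul_const' _ _ ENNReal.ofReal_ne_top]
    have : ENNReal.ofReal (I t / (n + 1)) * (n.factorial : ℝ≥0∞)⁻¹ * (ENNReal.ofReal (I t))⁻¹ =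
        ((n + 1).factorial : ℝ≥0∞)⁻¹ := by
      have hIt := hIpos t ht
      have hn : (0 : ℝ) < n + 1 := by positivity
      rw [ENNReal.ofReal_div_of_pos hn, div_eq_mul_inv, Nat.factorial_succ, Nat.cast_mul,
        ENNReal.mul_inv (by simp) (by simp),
        show ENNReal.ofReal ((n : ℝ) + 1) = ((n + 1 : ℕ) : ℝ≥0∞) by
          rw [← ENNReal.ofReal_natCast]; push_cast; rfl,
        mul_right_comm, mul_right_comm _ _ (ENNReal.ofReal (I t))⁻¹,
        ENNReal.mul_inv_cancel (by simpa using hIt) ENNReal.ofReal_ne_top, one_mul]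
    rw [← this, mul_assoc, mul_assoc, mul_assoc]

/-- eventual domination property of `R_I^m f*` for functions of
finitely-measured support. -/
theorem statement13 (m : ℕ) (hm : 1 ≤ m) (I : ℝ → ℝ)
    (hI : MonotoneOn I (Set.Ioi 0))
    (hIpos : ∀ t ∈ Set.Ioi (0 : ℝ), 0 < I t)
    (hIlc : ∀ t ∈ Set.Ioi (0 : ℝ), Filter.Tendsto I (𝓝[<] t) (𝓝 (I t)))
    (hPhi : EssentiallyDecreasingIn I m)
    (f : ℝ → ℝ≥0∞) (hf : Measurable f)
    (hsupp : volume {t : ℝ | t ∈ Set.Ioi (0 : ℝ) ∧ f t ≠ 0} < ∞) :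
    ∃ t₀ : ℝ, (volume {t : ℝ | t ∈ Set.Ioi (0 : ℝ) ∧ f t ≠ 0}).toReal ≤ t₀ ∧
      ∀ t : ℝ, t₀ ≤ t → ∃ rt ∈ Set.Ioi (0 : ℝ), ∀ r : ℝ, rt ≤ r →
        (RI I)^[m] (rearr f) r ≤ (RI I)^[m] (rearr f) t := by
  obtain ⟨n, rfl⟩ : ∃ n, m = n + 1 := ⟨m - 1, by omega⟩
  set L := (volume {t : ℝ | t ∈ Set.Ioi (0 : ℝ) ∧ f t ≠ 0}).toReal with hL
  have hL0 : 0 ≤ L := ENNReal.toReal_nonneg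
  obtain ⟨T, -, hT⟩ := hPhi (L + 1) (by simp only [mem_Ioi]; linarith)
  refine ⟨max L T + 1, (le_max_left L T).trans (by linarith), fun t ht => ?_⟩
  have hLt : L + 1 ≤ t := le_trans (by linarith [le_max_left L T]) ht
  obtain ⟨rt, hrt, h⟩ := hT t (by simp only [mem_Ioi]; linarith [le_max_right L T])
  refine ⟨rt + 1, by simp only [mem_Ioi] at hrt ⊢; linarith, fun r hr => ?_⟩
  have hr0 : 0 < r := by simp only [mem_Ioi] at hrt; linarith
  have hg : Measurable (rearr f) := (antitone_rearr f).measurable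
  rw [iterate_RI_eq_lintegral_Phi hI hIpos hg n hr0,
    iterate_RI_eq_lintegral_Phi hI hIpos hg n (by linarith)]
  refine ENNReal.div_le_div_right ?_ _
  rw [← lintegral_indicator measurableSet_Ioc, ← lintegral_indicator measurableSet_Ioc]
  refine lintegral_mono fun s => indicator_apply_le' (fun hs => ?_) fun _ => zero_le
  rcases le_or_gt L s with hLs | hLs
  · simp [rearr_eq_zero hsupp hLs]
  · rw [indicator_of_mem (show s ∈ Ioc 0 t from ⟨hs.1, by linarith⟩)]
    gcongr
    exact h r (by simp only [mem_Ioi]; linarith) s ⟨hs.1, by linarith⟩
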